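/- arXiv:1202.3655 — 5 statements merged into one kernel-verified Lean document; each statement's English description precedes it below -/
import Mathlib

section
/- Let d ≥ 1 be an integer, let V : ℝ^d → [0, ∞] be a Lebesgue-measurable function, let x ∈ ℝ^d, and let δ > 0. Then ∫_{B(x,δ)} ( ∫_0^∞ V(x + r·(y−x)/‖y−x‖) dr ) dy = (δ^d / d) ∫_{ℝ^d} ‖x − y‖^{1−d} V(y) dy, where both sides are Lebesgue integrals of nonnegative functions (taking values in [0, ∞]) and B(x,δ) = {y ∈ ℝ^d : ‖y − x‖ ≤ δ}. -/
open MeasureTheory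

lemma polar_aux {d : ℕ} (hd : 1 ≤ d) (f : EuclideanSpace ℝ (Fin d) → ENNReal)
    (hf : Measurable f) :
    ∫⁻ y, f y = ∫⁻ s : Metric.sphere (0 : EuclideanSpace ℝ (Fin d)) 1,
      (∫⁻ r in Set.Ioi (0:ℝ), ENNReal.ofReal (r ^ (d - 1)) * f (r • (s : EuclideanSpace ℝ (Fin d))))
        ∂(volume : Measure (EuclideanSpace ℝ (Fin d))).toSphere := by
  have : Nonempty (Fin d) := ⟨⟨0, hd⟩⟩
  set μ : Measure (EuclideanSpace ℝ (Fin d)) := volume with hμ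
  have h1 : ∫⁻ y, f y ∂μ
      = ∫⁻ y : ({(0 : EuclideanSpace ℝ (Fin d))}ᶜ : Set _), f y.1 ∂(μ.comap (↑)) := by
    rw [lintegral_subtype_comap (measurableSet_singleton _).compl f,
      restrict_compl_singleton]
  have h2 := μ.measurePreserving_homeomorphUnitSphereProd.lintegral_comp_emb
        (Homeomorph.measurableEmbedding _)
        (fun p => f (p.2.1 • p.1.1))
  have hm : Measurable (fun p : Metric.sphere (0 : EuclideanSpace ℝ (Fin d)) 1 × Set.Ioi (0:ℝ) =>
      f (p.2.1 • p.1.1)) := by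
    apply hf.comp
    fun_prop
  rw [lintegral_prod _ hm.aemeasurable] at h2
  rw [h1]
  refine Eq.trans ?_ (h2.trans ?_)
  · refine lintegral_congr fun y => ?_
    have hy : ‖(y : EuclideanSpace ℝ (Fin d))‖ ≠ 0 := norm_ne_zero_iff.2 y.2
    simp [smul_smul, hy]
  · refine lintegral_congr fun s => ?_
    have hms : Measurable (fun r : ℝ => f (r • (s : EuclideanSpace ℝ (Fin d)))) :=
      hf.comp (by fun_prop)
    rw [Measure.volumeIoiPow]
    refine (lintegral_withDensity_eq_lintegral_mul _ (by fun_prop)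
      (hms.comp measurable_subtype_coe)).trans ?_
    rw [← lintegral_subtype_comap measurableSet_Ioi]
    simp

lemma radial_aux {d : ℕ} (hd : 1 ≤ d) (δ : ℝ) (hδ : 0 < δ) :
    ∫⁻ r in Set.Ioi (0:ℝ), ENNReal.ofReal (r ^ (d - 1)) * (Set.Iic δ).indicator 1 r
      = ENNReal.ofReal (δ ^ d / d) := by
  have : ∀ r : ℝ, ENNReal.ofReal (r ^ (d - 1)) * (Set.Iic δ).indicator 1 r
      = (Set.Iic δ).indicator (fun r => ENNReal.ofReal (r ^ (d - 1))) r := by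
    intro r
    by_cases h : r ∈ Set.Iic δ <;> simp [h]
  simp_rw [this]
  rw [lintegral_indicator measurableSet_Iic, Measure.restrict_restrict measurableSet_Iic,
    Set.inter_comm, Set.Ioi_inter_Iic,
    ← ofReal_integral_eq_lintegral_ofReal (intervalIntegral.intervalIntegrable_pow _).1,
    ← intervalIntegral.integral_of_le hδ.le]
  · obtain ⟨n, rfl⟩ : ∃ n, d = n + 1 := ⟨d - 1, by omega⟩
    simp
  · filter_upwards [ae_restrict_mem measurableSet_Ioc] with y hy
    exact pow_nonneg hy.1.le _

theorem stmt_2 (d : ℕ) (hd : 1 ≤ d)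
    (V : EuclideanSpace ℝ (Fin d) → ENNReal) (hV : Measurable V)
    (x : EuclideanSpace ℝ (Fin d)) (δ : ℝ) (hδ : 0 < δ) :
    ∫⁻ y in Metric.closedBall x δ,
        ∫⁻ r in Set.Ioi (0:ℝ), V (x + r • (‖y - x‖⁻¹ • (y - x)))
      = ENNReal.ofReal (δ ^ d / d) *
          ∫⁻ y, ENNReal.ofReal (‖x - y‖ ^ ((1:ℝ) - d)) * V y := by
  set G : EuclideanSpace ℝ (Fin d) → ENNReal :=
    fun z => ∫⁻ r in Set.Ioi (0:ℝ), V (x + r • (‖z‖⁻¹ • z)) with hG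
  have hGm : Measurable G := by
    apply Measurable.lintegral_prod_right'
      (f := fun p : EuclideanSpace ℝ (Fin d) × ℝ => V (x + p.2 • (‖p.1‖⁻¹ • p.1)))
    apply hV.comp
    fun_prop
  have hL : ∫⁻ y in Metric.closedBall x δ, G (y - x)
      = ∫⁻ z, (Metric.closedBall 0 δ).indicator G z := by
    rw [← lintegral_indicator Metric.isClosed_closedBall.measurableSet,
      ← lintegral_sub_right_eq_self ((Metric.closedBall 0 δ).indicator G) x]
    refine lintegral_congr fun y => ?_
    by_cases h : dist y x ≤ δ
    · rw [Set.indicator_of_mem (by simpa using h),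
        Set.indicator_of_mem (by simpa [dist_eq_norm] using h)]
    · rw [Set.indicator_of_notMem (by simpa using h),
        Set.indicator_of_notMem (by simpa [dist_eq_norm] using h)]
  have hR : ∫⁻ y, ENNReal.ofReal (‖x - y‖ ^ ((1:ℝ) - d)) * V y
      = ∫⁻ z, ENNReal.ofReal (‖z‖ ^ ((1:ℝ) - d)) * V (x + z) := by
    rw [← lintegral_add_left_eq_self _ x]
    simp
  change ∫⁻ y in Metric.closedBall x δ, G (y - x) = _
  rw [hL, hR, polar_aux hd _ (hGm.indicator Metric.isClosed_closedBall.measurableSet),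
    polar_aux hd _ (by
      refine Measurable.mul ?_ (hV.comp (by fun_prop))
      exact (measurable_norm.pow_const _).ennreal_ofReal),
    ← lintegral_const_mul' _ _ ENNReal.ofReal_ne_top]
  refine lintegral_congr fun s => ?_
  have hs : ‖(s : EuclideanSpace ℝ (Fin d))‖ = 1 := by simp
  have e1 : ∀ r ∈ Set.Ioi (0:ℝ), ENNReal.ofReal (r ^ (d - 1)) *
      (Metric.closedBall 0 δ).indicator G (r • (s : EuclideanSpace ℝ (Fin d)))
      = (ENNReal.ofReal (r ^ (d - 1)) * (Set.Iic δ).indicator 1 r) * G s := by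
    intro r hr
    have hr' : 0 < r := hr
    have hn : ‖r • (s : EuclideanSpace ℝ (Fin d))‖ = r := by
      rw [norm_smul, hs, mul_one, Real.norm_of_nonneg hr'.le]
    have hg : G (r • (s : EuclideanSpace ℝ (Fin d))) = G s := by
      simp only [hG, hn, hs, smul_smul, mul_assoc, inv_mul_cancel₀ hr'.ne', inv_one, mul_one]
    by_cases h : r ≤ δ
    · rw [Set.indicator_of_mem (by rw [mem_closedBall_zero_iff, hn]; exact h),
        Set.indicator_of_mem (by exact h), hg]
      simp
    · rw [Set.indicator_of_notMem (by rw [mem_closedBall_zero_iff, hn]; exact h),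
        Set.indicator_of_notMem (by exact h)]
      simp
  rw [setLIntegral_congr_fun measurableSet_Ioi e1, lintegral_mul_const, radial_aux hd δ hδ]
  · congr 1
    simp only [hG]
    refine setLIntegral_congr_fun measurableSet_Ioi fun r hr => ?_
    have hr' : 0 < r := hr
    have hn : ‖r • (s : EuclideanSpace ℝ (Fin d))‖ = r := by
      rw [norm_smul, hs, mul_one, Real.norm_of_nonneg hr'.le]
    simp only [hn, hs, inv_one, one_smul]
    rw [← mul_assoc, ← ENNReal.ofReal_mul (by positivity), ← Real.rpow_natCast,
      ← Real.rpow_add hr', Nat.cast_sub hd]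
    simp
  · refine Measurable.mul (by fun_prop) (measurable_one.indicator measurableSet_Iic)
end

section
/- Let d ≥ 1 and n ≥ 0 be integers and ς > 0. There exist constants a₀, a₁, …, a_{n+1} > 0, depending only on d, n, and ς, such that for every h > 0, every bounded convex set K ⊂ ℝ^d with diameter at most h, every closed ball S ⊆ K of radius at least ς·h, and every function v : ℝ^d → ℝ of class C^{n+1} on a neighborhood of the closure of K, one has ∫_K v(x)² dx ≤ Σ_{j=0}^{n} a_j h^{2j} ∫_S ‖D^j v(x)‖² dx + a_{n+1} h^{2(n+1)} ∫_K ‖D^{n+1} v(x)‖² dx. -/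
open MeasureTheory

lemma aux_scale (d : ℕ) (g : EuclideanSpace ℝ (Fin d) → ENNReal) (hg : Measurable g)
    (s : ℝ) (hs : 1 / 2 ≤ s) (c : EuclideanSpace ℝ (Fin d)) :
    ∫⁻ x, g (s • x + c) ≤ 2 ^ d * ∫⁻ x, g x := by
  have hs0 : s ≠ 0 := by linarith
  have h1 : ∫⁻ x, g (s • x + c) = ∫⁻ y, g (y + c) ∂(Measure.map (s • ·) volume) := by
    rw [lintegral_map (by fun_prop) (by fun_prop)]
  rw [h1, Measure.map_addHaar_smul _ hs0, lintegral_smul_measure, lintegral_add_right_eq_self,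
    smul_eq_mul]
  gcongr
  have : (2 : ENNReal) ^ d = ENNReal.ofReal (2 ^ d) := by
    rw [ENNReal.ofReal_pow (by norm_num)]; simp
  rw [this]
  apply ENNReal.ofReal_le_ofReal
  simp only [finrank_euclideanSpace, Fintype.card_fin]
  rw [abs_of_pos (by positivity), ← inv_pow]
  gcongr
  rw [inv_le_comm₀ (by linarith) (by norm_num)]
  linarith

lemma aux_lint (d : ℕ) (f g : EuclideanSpace ℝ (Fin d) → ENNReal) (hf : Measurable f)
    (hg : Measurable g) (H : ENNReal) (K S : Set (EuclideanSpace ℝ (Fin d)))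
    (hK : MeasurableSet K) (hS : MeasurableSet S) (hSK : S ⊆ K)
    (hfg : ∀ x ∈ K, ∀ y ∈ S, f x ≤ 2 * f y +
      H * ∫⁻ t in Set.Ioc (0 : ℝ) 1, g (y + t • (x - y))) :
    volume S * ∫⁻ x in K, f x ≤ volume K * (2 * ∫⁻ x in S, f x) +
      H * (volume K * (2 ^ d * ∫⁻ x, g x)) := by
  have key : ∀ t ∈ Set.Ioc (0 : ℝ) 1, ∫⁻ x in K, ∫⁻ y in S, g (y + t • (x - y)) ≤
      volume K * (2 ^ d * ∫⁻ x, g x) := by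
    intro t ht
    rcases le_total t (1 / 2) with h | h
    · calc ∫⁻ x in K, ∫⁻ y in S, g (y + t • (x - y))
          ≤ ∫⁻ x in K, (2 ^ d * ∫⁻ x, g x) := by
            apply lintegral_mono
            intro x
            refine (setLIntegral_le_lintegral _ _).trans ?_
            have := aux_scale d g hg (1 - t) (by linarith) (t • x)
            refine le_of_eq_of_le (lintegral_congr fun y => ?_) this
            congr 1
            module
        _ = _ := by simp [mul_comm]
    · calc ∫⁻ x in K, ∫⁻ y in S, g (y + t • (x - y))
          = ∫⁻ y in S, ∫⁻ x in K, g (y + t • (x - y)) := by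
            apply lintegral_lintegral_swap
            apply Measurable.aemeasurable
            fun_prop
        _ ≤ ∫⁻ y in S, (2 ^ d * ∫⁻ x, g x) := by
            apply lintegral_mono
            intro y
            refine (setLIntegral_le_lintegral _ _).trans ?_
            have := aux_scale d g hg t h ((1 - t) • y)
            refine le_of_eq_of_le (lintegral_congr fun x => ?_) this
            congr 1
            module
        _ = volume S * (2 ^ d * ∫⁻ x, g x) := by simp [mul_comm]
        _ ≤ _ := by gcongr
  have hm3 : Measurable (fun p : (EuclideanSpace ℝ (Fin d) × EuclideanSpace ℝ (Fin d)) × ℝ =>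
      g (p.1.2 + p.2 • (p.1.1 - p.1.2))) := by fun_prop
  have hm2 : Measurable (fun p : EuclideanSpace ℝ (Fin d) × EuclideanSpace ℝ (Fin d) =>
      ∫⁻ t in Set.Ioc (0 : ℝ) 1, g (p.2 + t • (p.1 - p.2))) := hm3.lintegral_prod_right'
  have swap : ∫⁻ x in K, ∫⁻ y in S, ∫⁻ t in Set.Ioc (0 : ℝ) 1, g (y + t • (x - y)) =
      ∫⁻ t in Set.Ioc (0 : ℝ) 1, ∫⁻ x in K, ∫⁻ y in S, g (y + t • (x - y)) := by
    have e1 : ∀ x, ∫⁻ y in S, ∫⁻ t in Set.Ioc (0 : ℝ) 1, g (y + t • (x - y)) =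
        ∫⁻ t in Set.Ioc (0 : ℝ) 1, ∫⁻ y in S, g (y + t • (x - y)) := by
      intro x
      apply lintegral_lintegral_swap
      apply Measurable.aemeasurable
      fun_prop
    simp_rw [e1]
    apply lintegral_lintegral_swap
    apply Measurable.aemeasurable
    have : Measurable (fun p : (EuclideanSpace ℝ (Fin d) × ℝ) × EuclideanSpace ℝ (Fin d) =>
      g (p.2 + p.1.2 • (p.1.1 - p.2))) := by fun_prop
    exact this.lintegral_prod_right'
  calc volume S * ∫⁻ x in K, f x = ∫⁻ x in K, ∫⁻ y in S, f x := by
        simp only [setLIntegral_const]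
        rw [lintegral_mul_const _ hf, mul_comm]
    _ ≤ ∫⁻ x in K, ∫⁻ y in S, (2 * f y +
      H * ∫⁻ t in Set.Ioc (0 : ℝ) 1, g (y + t • (x - y))) := by
        apply setLIntegral_mono' hK
        intro x hx
        apply setLIntegral_mono' hS
        intro y hy
        exact hfg x hx y hy
    _ = ∫⁻ x in K, ((2 * ∫⁻ y in S, f y) +
      H * ∫⁻ y in S, ∫⁻ t in Set.Ioc (0 : ℝ) 1, g (y + t • (x - y))) := by
        apply lintegral_congr
        intro x
        rw [lintegral_add_left (by fun_prop), lintegral_const_mul _ hf, lintegral_const_mul]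
        exact hm2.comp (measurable_const.prodMk measurable_id)
    _ = volume K * (2 * ∫⁻ x in S, f x) + H * ∫⁻ x in K, ∫⁻ y in S,
          ∫⁻ t in Set.Ioc (0 : ℝ) 1, g (y + t • (x - y)) := by
        rw [lintegral_add_left (by fun_prop), lintegral_const_mul H, setLIntegral_const,
          mul_comm (volume K)]
        · exact hm2.lintegral_prod_right'
    _ ≤ _ := by
        rw [swap]
        gcongr
        calc _ ≤ ∫⁻ t in Set.Ioc (0 : ℝ) 1, volume K * (2 ^ d * ∫⁻ x, g x) :=
              setLIntegral_mono' measurableSet_Ioc key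
          _ = _ := by simp

lemma aux_pt {E F : Type*} [NormedAddCommGroup E] [NormedSpace ℝ E] [NormedAddCommGroup F]
    [NormedSpace ℝ F] [CompleteSpace F] (w : E → F) (K : Set E)
    (hK : Convex ℝ K) (hw : ∀ x ∈ K, DifferentiableAt ℝ w x) (hw' : ContinuousOn (fderiv ℝ w) K)
    (x y : E) (hx : x ∈ K) (hy : y ∈ K) :
    ‖w x‖ ^ 2 ≤ 2 * ‖w y‖ ^ 2 + 2 * ‖x - y‖ ^ 2 *
      ∫ t in (0 : ℝ)..1, ‖fderiv ℝ w (y + t • (x - y))‖ ^ 2 := by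
  have hmem : ∀ t ∈ Set.uIcc (0 : ℝ) 1, y + t • (x - y) ∈ K := by
    intro t ht
    rw [Set.uIcc_of_le zero_le_one] at ht
    exact hK.add_smul_sub_mem hy hx ht
  have hc0 : ContinuousOn (fun t : ℝ => fderiv ℝ w (y + t • (x - y))) (Set.uIcc 0 1) :=
    hw'.comp (by fun_prop) hmem
  have hd : ∀ t ∈ Set.uIcc (0 : ℝ) 1, HasDerivAt (fun t : ℝ => w (y + t • (x - y)))
      (fderiv ℝ w (y + t • (x - y)) (x - y)) t := by
    intro t ht
    have h1 : HasDerivAt (fun t : ℝ => y + t • (x - y)) (x - y) t := by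
      simpa using ((hasDerivAt_id t).smul_const (x - y)).const_add y
    exact (hw _ (hmem t ht)).hasFDerivAt.comp_hasDerivAt t h1
  have hftc := intervalIntegral.integral_eq_sub_of_hasDerivAt hd
    ((hc0.clm_apply continuousOn_const).intervalIntegrable)
  simp only [one_smul, zero_smul, add_zero, add_sub_cancel] at hftc
  set p : ℝ → ℝ := fun t => ‖fderiv ℝ w (y + t • (x - y))‖ with hp
  have hpc : ContinuousOn p (Set.uIcc 0 1) := hc0.norm
  have hpi : IntervalIntegrable p volume 0 1 := hpc.intervalIntegrable
  have hp2 : IntervalIntegrable (fun t => p t ^ 2) volume 0 1 := (hpc.pow 2).intervalIntegrable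
  set m := ∫ t in (0 : ℝ)..1, p t with hm
  have hcs : m ^ 2 ≤ ∫ t in (0 : ℝ)..1, p t ^ 2 := by
    have h0 : 0 ≤ ∫ t in (0 : ℝ)..1, (p t - m) ^ 2 :=
      intervalIntegral.integral_nonneg zero_le_one (fun t _ => sq_nonneg _)
    have h1 : ∫ t in (0 : ℝ)..1, (p t - m) ^ 2 =
        (∫ t in (0 : ℝ)..1, p t ^ 2) - 2 * m * m + m ^ 2 := by
      have : ∀ t, (p t - m) ^ 2 = p t ^ 2 - 2 * m * p t + m ^ 2 := fun t => by ring
      simp_rw [this]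
      rw [intervalIntegral.integral_add (hp2.sub (hpi.const_mul _)) (by simp),
        intervalIntegral.integral_sub hp2 (hpi.const_mul _),
        intervalIntegral.integral_const_mul]
      simp [hm]
    nlinarith
  have hb : ‖w x - w y‖ ≤ m * ‖x - y‖ := by
    rw [← hftc, hm, ← intervalIntegral.integral_mul_const]
    apply intervalIntegral.norm_integral_le_of_norm_le zero_le_one
    · exact Filter.Eventually.of_forall (fun t _ => ContinuousLinearMap.le_opNorm _ _)
    · exact hpi.mul_const _
  have hb2 : ‖w x - w y‖ ^ 2 ≤ ‖x - y‖ ^ 2 * ∫ t in (0 : ℝ)..1, p t ^ 2 := by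
    calc ‖w x - w y‖ ^ 2 ≤ (m * ‖x - y‖) ^ 2 := by gcongr
      _ = ‖x - y‖ ^ 2 * m ^ 2 := by ring
      _ ≤ _ := by gcongr
  have ht : ‖w x‖ ≤ ‖w y‖ + ‖w x - w y‖ := by
    have := norm_add_le (w y) (w x - w y)
    simpa using this
  have ht2 : ‖w x‖ ^ 2 ≤ (‖w y‖ + ‖w x - w y‖) ^ 2 := by gcongr
  nlinarith [sq_nonneg (‖w y‖ - ‖w x - w y‖)]

lemma aux_first (d : ℕ) {F : Type*} [NormedAddCommGroup F]
    [NormedSpace ℝ F] [CompleteSpace F] (ς h r : ℝ) (hς : 0 < ς) (hh : 0 < h)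
    (K : Set (EuclideanSpace ℝ (Fin d))) (hKc : IsCompact K) (hK : Convex ℝ K)
    (hdiam : Metric.diam K ≤ h) (z : EuclideanSpace ℝ (Fin d)) (hr : ς * h ≤ r)
    (hS : Metric.closedBall z r ⊆ K)
    (w : EuclideanSpace ℝ (Fin d) → F) 
    (hw : ∀ x ∈ K, DifferentiableAt ℝ w x) (hw' : ContinuousOn (fderiv ℝ w) K) :
    ∫ x in K, ‖w x‖ ^ 2 ≤ (2 / ς ^ d) * (∫ x in Metric.closedBall z r, ‖w x‖ ^ 2) +
      (2 * 2 ^ d / ς ^ d) * h ^ 2 * ∫ x in K, ‖fderiv ℝ w x‖ ^ 2 := by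
  set S := Metric.closedBall z r with hSdef
  have hr0 : 0 < r := lt_of_lt_of_le (by positivity) hr
  have hzK : z ∈ K := hS (Metric.mem_closedBall_self hr0.le)
  have hKm := hKc.measurableSet
  have hSm : MeasurableSet S := Metric.isClosed_closedBall.measurableSet
  have hwc : ContinuousOn (fun x => ‖w x‖ ^ 2) K := by
    have : ContinuousOn w K := fun x hx => (hw x hx).continuousAt.continuousWithinAt
    exact this.norm.pow 2
  have hgc : ContinuousOn (fun x => ‖fderiv ℝ w x‖ ^ 2) K := hw'.norm.pow 2
  have hmeas : ∀ q : EuclideanSpace ℝ (Fin d) → ℝ, ContinuousOn q K →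
      Measurable (K.indicator (fun x => ENNReal.ofReal (q x))) := by
    intro q hq
    classical
    rw [← Set.piecewise_eq_indicator]
    exact (ENNReal.continuous_ofReal.comp_continuousOn hq).measurable_piecewise
      continuousOn_const hKm
  have hdist : ∀ x ∈ K, ∀ y ∈ K, ‖x - y‖ ≤ h := fun x hx y hy => by
    rw [← dist_eq_norm]; exact (Metric.dist_le_diam_of_mem hKc.isBounded hx hy).trans hdiam
  have conv : ∀ q : EuclideanSpace ℝ (Fin d) → ℝ, ContinuousOn q K → (∀ x, 0 ≤ q x) →
      ∀ T ⊆ K, MeasurableSet T →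
      ∫⁻ x in T, K.indicator (fun x => ENNReal.ofReal (q x)) x = ENNReal.ofReal (∫ x in T, q x) := by
    intro q hq hq0 T hT hTm
    rw [ofReal_integral_eq_lintegral_ofReal ((hq.integrableOn_compact hKc).mono_set hT)
      (Filter.Eventually.of_forall hq0)]
    apply setLIntegral_congr_fun hTm
    intro x hx
    simp [hT hx]
  have main := aux_lint d _ _ (hmeas _ hwc) (hmeas _ hgc) (ENNReal.ofReal (2 * h ^ 2)) K S hKm hSm hS
    (by
      intro x hx y hy
      have hyK := hS hy
      have hp := aux_pt w K hK hw hw' x y hx hyK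
      have hmem : ∀ t ∈ Set.Icc (0 : ℝ) 1, y + t • (x - y) ∈ K := by
        intro t ht
        exact hK.add_smul_sub_mem hyK hx ht
      have hcc : ContinuousOn (fun t : ℝ => ‖fderiv ℝ w (y + t • (x - y))‖ ^ 2) (Set.Icc 0 1) :=
        hgc.comp (f := fun t : ℝ => y + t • (x - y)) (by fun_prop) hmem
      have e : ∫⁻ t in Set.Ioc (0 : ℝ) 1, K.indicator
          (fun x => ENNReal.ofReal (‖fderiv ℝ w x‖ ^ 2)) (y + t • (x - y)) =
          ENNReal.ofReal (∫ t in (0 : ℝ)..1, ‖fderiv ℝ w (y + t • (x - y))‖ ^ 2) := by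
        rw [intervalIntegral.integral_of_le zero_le_one, ofReal_integral_eq_lintegral_ofReal
          ((hcc.integrableOn_compact isCompact_Icc).mono_set Set.Ioc_subset_Icc_self)
          (Filter.Eventually.of_forall fun t => by positivity)]
        apply setLIntegral_congr_fun measurableSet_Ioc
        intro t ht
        simp [hmem t (Set.Ioc_subset_Icc_self ht)]
      have hI0 : 0 ≤ ∫ t in (0 : ℝ)..1, ‖fderiv ℝ w (y + t • (x - y))‖ ^ 2 :=
        intervalIntegral.integral_nonneg zero_le_one (fun t _ => by positivity)
      rw [e, Set.indicator_of_mem hx, Set.indicator_of_mem hyK]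
      have e2 : 2 * ENNReal.ofReal (‖w y‖ ^ 2) = ENNReal.ofReal (2 * ‖w y‖ ^ 2) := by
        rw [ENNReal.ofReal_mul (by norm_num)]; simp
      rw [← ENNReal.ofReal_mul (by positivity), e2, ← ENNReal.ofReal_add (by positivity) (by positivity)]
      apply ENNReal.ofReal_le_ofReal
      refine hp.trans ?_
      gcongr
      exact hdist x hx y hyK)
  have hfull : ∫⁻ x, K.indicator (fun x => ENNReal.ofReal (‖fderiv ℝ w x‖ ^ 2)) x =
      ENNReal.ofReal (∫ x in K, ‖fderiv ℝ w x‖ ^ 2) := by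
    rw [← conv _ hgc (fun x => by positivity) K subset_rfl hKm, ← lintegral_indicator hKm,
      Set.indicator_indicator, Set.inter_self]
  rw [hfull, conv _ hwc (fun x => by positivity) K subset_rfl hKm,
    conv _ hwc (fun x => by positivity) S hS hSm] at main
  set A := ∫ x in K, ‖w x‖ ^ 2
  set B := ∫ x in S, ‖w x‖ ^ 2
  set C := ∫ x in K, ‖fderiv ℝ w x‖ ^ 2
  have hA : 0 ≤ A := integral_nonneg fun x => by positivity
  have hB : 0 ≤ B := integral_nonneg fun x => by positivity
  have hC : 0 ≤ C := integral_nonneg fun x => by positivity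
  -- volumes
  have hKfin : volume K ≠ ⊤ := hKc.measure_lt_top.ne
  have hSfin : volume S ≠ ⊤ := (isCompact_closedBall z r).measure_lt_top.ne
  have hreal : (volume S).toReal * A ≤ (volume K).toReal * (2 * B) +
      (2 * h ^ 2) * ((volume K).toReal * (2 ^ d * C)) := by
    have := ENNReal.toReal_mono (by finiteness) main
    rw [ENNReal.toReal_add (by finiteness) (by finiteness)] at this
    simp only [ENNReal.toReal_mul, ENNReal.toReal_ofReal hA, ENNReal.toReal_ofReal hB,
      ENNReal.toReal_ofReal hC, ENNReal.toReal_pow, ENNReal.toReal_ofNat,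
      ENNReal.toReal_ofReal (show 0 ≤ 2 * h ^ 2 by positivity)] at this
    exact this
  set β := (volume (Metric.closedBall (0 : EuclideanSpace ℝ (Fin d)) 1)).toReal with hβ
  have hSv : (volume S).toReal = r ^ d * β := by
    have := Measure.addHaar_real_closedBall' volume z hr0.le
    simpa [measureReal_def] using this
  have hKv : (volume K).toReal ≤ h ^ d * β := by
    have := Measure.addHaar_real_closedBall' volume z hh.le
    simp only [measureReal_def, finrank_euclideanSpace, Fintype.card_fin] at this
    rw [hβ, ← this]
    apply ENNReal.toReal_mono (isCompact_closedBall z h).measure_lt_top.ne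
    apply measure_mono
    intro x hx
    rw [Metric.mem_closedBall, dist_eq_norm]
    exact hdist x hx z hzK
  have hβ0 : 0 < β := by
    apply ENNReal.toReal_pos
    · exact (Metric.measure_closedBall_pos volume _ one_pos).ne'
    · exact (isCompact_closedBall _ _).measure_lt_top.ne
  have hrr : (ς * h) ^ d * β ≤ (volume S).toReal := by
    rw [hSv]; gcongr
  have h1 : (ς * h) ^ d * β * A ≤ (h ^ d * β) * (2 * B + (2 * h ^ 2) * (2 ^ d * C)) := by
    calc _ ≤ (volume S).toReal * A := by gcongr
      _ ≤ _ := hreal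
      _ = (volume K).toReal * (2 * B + (2 * h ^ 2) * (2 ^ d * C)) := by ring
      _ ≤ _ := by gcongr
  have h2 : ς ^ d * A ≤ 2 * B + (2 * h ^ 2) * (2 ^ d * C) := by
    have hp : 0 < h ^ d * β := by positivity
    refine le_of_mul_le_mul_left ?_ hp
    calc _ = (ς * h) ^ d * β * A := by ring
      _ ≤ _ := h1
  have hςd : 0 < ς ^ d := by positivity
  have h3 : A ≤ (2 * B + (2 * h ^ 2) * (2 ^ d * C)) / ς ^ d := by
    rw [le_div_iff₀ hςd]; linarith
  refine h3.trans (le_of_eq ?_)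
  ring

theorem stmt_4 (d n : ℕ) (hd : 1 ≤ d) (ς : ℝ) (hς : 0 < ς) :
    ∃ a : ℕ → ℝ, (∀ j ≤ n + 1, 0 < a j) ∧
      ∀ (h : ℝ), 0 < h →
      ∀ K : Set (EuclideanSpace ℝ (Fin d)),
        Convex ℝ K → Bornology.IsBounded K → Metric.diam K ≤ h →
      ∀ (z : EuclideanSpace ℝ (Fin d)) (r : ℝ),
        ς * h ≤ r → Metric.closedBall z r ⊆ K →
      ∀ (v : EuclideanSpace ℝ (Fin d) → ℝ) (U : Set (EuclideanSpace ℝ (Fin d))),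
        IsOpen U → closure K ⊆ U → ContDiffOn ℝ (n + 1 : ℕ) v U →
        ∫ x in K, (v x) ^ 2 ≤
          (∑ j ∈ Finset.range (n + 1),
            a j * h ^ (2 * j) * ∫ x in Metric.closedBall z r, ‖iteratedFDeriv ℝ j v x‖ ^ 2)
          + a (n + 1) * h ^ (2 * (n + 1)) * ∫ x in K, ‖iteratedFDeriv ℝ (n + 1) v x‖ ^ 2 := by
  set α : ℝ := 2 / ς ^ d with hα
  set γ : ℝ := 2 * 2 ^ d / ς ^ d with hγ
  have hα0 : 0 < α := by positivity
  have hγ0 : 0 < γ := by positivity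
  refine ⟨fun j => if j = n + 1 then γ ^ j else γ ^ j * α, fun j _ => ?_, ?_⟩
  · dsimp only
    split_ifs <;> positivity
  intro h hh K hK hKb hdiam z r hr hS v U hU hKU hv
  have hcl : K =ᵐ[volume] closure K := by
    have h0 := hK.addHaar_frontier volume
    rw [ae_eq_set]
    constructor
    · simp [Set.sdiff_eq_empty.2 subset_closure]
    · exact measure_mono_null (Set.sdiff_subset_sdiff_right interior_subset) h0
  have step : ∀ j ≤ n, ∫ x in K, ‖iteratedFDeriv ℝ j v x‖ ^ 2 ≤
      α * (∫ x in Metric.closedBall z r, ‖iteratedFDeriv ℝ j v x‖ ^ 2) +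
      γ * h ^ 2 * ∫ x in K, ‖iteratedFDeriv ℝ (j + 1) v x‖ ^ 2 := by
    intro j hj
    have hcd : ContDiffOn ℝ 1 (iteratedFDeriv ℝ j v) U := by
      intro x hx
      have := (hv x hx).contDiffAt (hU.mem_nhds hx)
      refine (this.iteratedFDeriv_right (m := 1) ?_).contDiffWithinAt
      have : 1 + j ≤ n + 1 := by omega
      exact_mod_cast this
    have := aux_first d ς h r hς hh (closure K) hKb.isCompact_closure hK.closure
      (by rwa [Metric.diam, Metric.ediam_closure]) z hr (hS.trans subset_closure)
      (iteratedFDeriv ℝ j v)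
      (fun x hx => (hcd.differentiableOn one_ne_zero).differentiableAt (hU.mem_nhds (hKU hx)))
      ((hcd.continuousOn_fderiv_of_isOpen hU le_rfl).mono hKU)
    simp_rw [norm_fderiv_iteratedFDeriv] at this
    rwa [setIntegral_congr_set hcl, setIntegral_congr_set hcl]
  have ind : ∀ m ≤ n + 1, ∫ x in K, (v x) ^ 2 ≤
      (∑ j ∈ Finset.range m, γ ^ j * α * h ^ (2 * j) *
        ∫ x in Metric.closedBall z r, ‖iteratedFDeriv ℝ j v x‖ ^ 2) +
      γ ^ m * h ^ (2 * m) * ∫ x in K, ‖iteratedFDeriv ℝ m v x‖ ^ 2 := by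
    intro m
    induction m with
    | zero => intro _; simp
    | succ m ih =>
      intro hm
      refine (ih (by omega)).trans ?_
      rw [Finset.sum_range_succ, add_assoc]
      gcongr
      calc _ ≤ γ ^ m * h ^ (2 * m) *
          (α * (∫ x in Metric.closedBall z r, ‖iteratedFDeriv ℝ m v x‖ ^ 2) +
            γ * h ^ 2 * ∫ x in K, ‖iteratedFDeriv ℝ (m + 1) v x‖ ^ 2) := by
            gcongr
            exact step m (by omega)
        _ = _ := by ring
  refine (ind (n + 1) le_rfl).trans (le_of_eq ?_)
  simp only [if_true]
  congr 1
  apply Finset.sum_congr rfl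
  intro j hj
  rw [if_neg (by simp at hj; omega)]
end

section
/- Let d ≥ 1 and n ≥ 0 be integers and ς > 0. There exist constants a₀, a₁, …, a_n > 0, depending only on d, n, and ς, such that for every h > 0, every bounded convex set K ⊂ ℝ^d with diameter at most h, every closed ball S ⊆ K of radius at least ς·h, and every polynomial function v : ℝ^d → ℝ of total degree at most n, one has ∫_K v(x)² dx ≤ Σ_{j=0}^{n} a_j h^{2j} ∫_S ‖D^j v(x)‖² dx. -/
open MeasureTheory

lemma aux_iter (Q : Polynomial ℝ) (k : ℕ) :
    iteratedDeriv k (fun t => Q.eval t) = fun t => (Polynomial.derivative^[k] Q).eval t := by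
  induction k with
  | zero => simp
  | succ k ih =>
    rw [iteratedDeriv_succ, ih, Function.iterate_succ_apply']
    funext t
    simp

lemma aux_smooth {d : ℕ} (p : MvPolynomial (Fin d) ℝ) :
    ContDiff ℝ (⊤ : ℕ∞) (fun x : EuclideanSpace ℝ (Fin d) => MvPolynomial.eval (fun i => x i) p) := by
  induction p using MvPolynomial.induction_on with
  | C a => simpa using contDiff_const
  | add p q hp hq => simpa using hp.add hq
  | mul_X p i hp =>
    simp only [map_mul, MvPolynomial.eval_X]
    exact hp.mul (by fun_prop)

lemma aux_taylor {d n : ℕ} (p : MvPolynomial (Fin d) ℝ) (hp : p.totalDegree ≤ n)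
    (v : EuclideanSpace ℝ (Fin d) → ℝ)
    (hv : ∀ x, v x = MvPolynomial.eval (fun i => x i) p) (hs : ContDiff ℝ (⊤ : ℕ∞) v)
    (y w : EuclideanSpace ℝ (Fin d)) :
    v (y + w) = ∑ j ∈ Finset.range (n + 1),
      ((j.factorial : ℝ))⁻¹ * iteratedFDeriv ℝ j v y (fun _ => w) := by
  set Q : Polynomial ℝ := MvPolynomial.aeval
    (fun i => Polynomial.C (w i) * Polynomial.X + Polynomial.C (y i)) p with hQ
  have hdeg : Q.natDegree ≤ n :=
    MvPolynomial.aeval_natDegree_le (n := 1) p hp _ (fun i => Polynomial.natDegree_linear_le) |>.trans (by simp)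
  have hQe : ∀ t : ℝ, v (y + t • w) = Q.eval t := by
    intro t
    rw [hv, hQ, ← Polynomial.coe_evalRingHom, MvPolynomial.aeval_def, MvPolynomial.hom_eval₂]
    have : ((Polynomial.evalRingHom t).comp (algebraMap ℝ (Polynomial ℝ))) = RingHom.id ℝ := by
      ext; simp
    rw [this, MvPolynomial.eval, MvPolynomial.coe_eval₂Hom]
    congr 1
    funext i
    simp
    ring
  have hder : ∀ j : ℕ, iteratedFDeriv ℝ j v y (fun _ => w) = (j.factorial : ℝ) * Q.coeff j := by
    intro j
    have h1 : iteratedDeriv j (fun t => Q.eval t) 0 = (j.factorial : ℝ) * Q.coeff j := by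
      rw [aux_iter]
      simp only
      rw [← Polynomial.coeff_zero_eq_eval_zero, Polynomial.coeff_iterate_derivative]
      simp [Nat.descFactorial_self]
    rw [← h1, iteratedDeriv_eq_iteratedFDeriv]
    have h2 : (fun t => Q.eval t) =
        (fun x => v (y + x)) ∘ (ContinuousLinearMap.toSpanSingleton ℝ w) := by
      funext t
      simp [← hQe]
    have h3 : ContDiff ℝ (⊤ : ℕ∞) (fun x => v (y + x)) := hs.comp (by fun_prop)
    rw [h2, ContinuousLinearMap.iteratedFDeriv_comp_right _ h3 _ (i := j) (by exact_mod_cast le_top)]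
    simp [iteratedFDeriv_comp_add_left]
  have := hQe 1
  rw [one_smul] at this
  rw [this, Polynomial.eval_eq_sum_range' (Nat.lt_succ_of_le hdeg)]
  refine Finset.sum_congr rfl fun j _ => ?_
  rw [hder]
  have : (j.factorial : ℝ) ≠ 0 := by positivity
  field_simp
  simp

lemma aux_point {d n : ℕ} (p : MvPolynomial (Fin d) ℝ) (hp : p.totalDegree ≤ n)
    (v : EuclideanSpace ℝ (Fin d) → ℝ)
    (hv : ∀ x, v x = MvPolynomial.eval (fun i => x i) p) (hs : ContDiff ℝ (⊤ : ℕ∞) v)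
    (y w : EuclideanSpace ℝ (Fin d)) (M : ℝ) (hw : ‖w‖ ≤ M) :
    v (y + w) ^ 2 ≤ ∑ j ∈ Finset.range (n + 1),
      (n + 1 : ℝ) * M ^ (2 * j) * ‖iteratedFDeriv ℝ j v y‖ ^ 2 := by
  rw [aux_taylor p hp v hv hs y w]
  refine sq_sum_le_card_mul_sum_sq.trans ?_
  rw [Finset.card_range, Finset.mul_sum]
  push_cast
  refine Finset.sum_le_sum fun j _ => ?_
  rw [mul_assoc]
  refine mul_le_mul_of_nonneg_left ?_ (by positivity)
  rw [pow_mul', ← mul_pow]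
  refine sq_le_sq' ?_ ?_ <;> [rw [neg_le]; skip]
  all_goals
    have hM : 0 ≤ M := (norm_nonneg _).trans hw
    have h1 : |(j.factorial : ℝ)⁻¹ * iteratedFDeriv ℝ j v y (fun _ => w)|
        ≤ M ^ j * ‖iteratedFDeriv ℝ j v y‖ := by
      rw [abs_mul]
      have h2 := (iteratedFDeriv ℝ j v y).le_opNorm (fun _ => w)
      simp only [Finset.prod_const, Finset.card_univ, Fintype.card_fin, Real.norm_eq_abs] at h2
      have h3 : |(j.factorial : ℝ)⁻¹| ≤ 1 := by
        rw [abs_of_nonneg (by positivity)]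
        exact inv_le_one_of_one_le₀ (by exact_mod_cast Nat.factorial_pos j)
      calc _ ≤ 1 * (‖iteratedFDeriv ℝ j v y‖ * ‖w‖ ^ j) := by gcongr
        _ ≤ 1 * (‖iteratedFDeriv ℝ j v y‖ * M ^ j) := by gcongr
        _ = _ := by ring
  · exact (neg_le_abs _).trans h1
  · exact (le_abs_self _).trans h1

lemma aux_cov {d : ℕ} (F : EuclideanSpace ℝ (Fin d) → ℝ)
    (z : EuclideanSpace ℝ (Fin d)) (s h : ℝ) (hs : 0 < s) :
    ∫ x in Metric.closedBall z h, F (z + s • (x - z)) =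
      (s ^ d)⁻¹ * ∫ x in Metric.closedBall z (s * h), F x := by
  have key : ∀ (G : EuclideanSpace ℝ (Fin d) → ℝ) (ρ : ℝ),
      ∫ x in Metric.closedBall z ρ, G x = ∫ u in Metric.closedBall 0 ρ, G (z + u) := by
    intro G ρ
    rw [← (measurePreserving_add_left volume z).setIntegral_preimage_emb
      (measurableEmbedding_addLeft z)]
    simp
  rw [key, key]
  simp only [add_sub_cancel_left]
  rw [Measure.setIntegral_comp_smul_of_pos volume (fun u => F (z + u)) _ hs]
  simp [smul_closedBall', hs.ne', abs_of_pos hs]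

theorem stmt_5 (d n : ℕ) (hd : 1 ≤ d) (ς : ℝ) (hς : 0 < ς) :
    ∃ a : ℕ → ℝ, (∀ j ≤ n, 0 < a j) ∧
      ∀ (h : ℝ), 0 < h →
      ∀ K : Set (EuclideanSpace ℝ (Fin d)),
        Convex ℝ K → Bornology.IsBounded K → Metric.diam K ≤ h →
      ∀ (z : EuclideanSpace ℝ (Fin d)) (r : ℝ),
        ς * h ≤ r → Metric.closedBall z r ⊆ K →
      ∀ (p : MvPolynomial (Fin d) ℝ), p.totalDegree ≤ n →
      ∀ v : EuclideanSpace ℝ (Fin d) → ℝ,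
        (∀ x, v x = MvPolynomial.eval (fun i => x i) p) →
        ∫ x in K, (v x) ^ 2 ≤
          ∑ j ∈ Finset.range (n + 1),
            a j * h ^ (2 * j) * ∫ x in Metric.closedBall z r, ‖iteratedFDeriv ℝ j v x‖ ^ 2 := by
  refine ⟨fun j => (n + 1) * (1 + ς) ^ (2 * j) * (ς ^ d)⁻¹, fun j _ => by positivity, ?_⟩
  intro h hh K _ hb hdiam z r hr hSK p hp v hv
  have hs : ContDiff ℝ (⊤ : ℕ∞) v := by
    have : v = fun x => MvPolynomial.eval (fun i => x i) p := funext hv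
    rw [this]; exact aux_smooth p
  have hcD : ∀ j : ℕ, Continuous (fun x => ‖iteratedFDeriv ℝ j v x‖ ^ 2) := fun j =>
    ((hs.continuous_iteratedFDeriv (m := j) (by exact_mod_cast le_top)).norm.pow 2)
  have hint : ∀ {G : EuclideanSpace ℝ (Fin d) → ℝ}, Continuous G → ∀ ρ : ℝ,
      IntegrableOn G (Metric.closedBall z ρ) := fun hG ρ =>
    hG.continuousOn.integrableOn_compact (isCompact_closedBall z ρ)
  have hzK : z ∈ K := hSK (Metric.mem_closedBall_self ((mul_pos hς hh).le.trans hr))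
  have hKB : K ⊆ Metric.closedBall z h := fun x hx =>
    (Metric.dist_le_diam_of_mem hb hx hzK).trans hdiam
  have hc1 : ∀ j : ℕ, Continuous fun x : EuclideanSpace ℝ (Fin d) =>
      ‖iteratedFDeriv ℝ j v (z + ς • (x - z))‖ ^ 2 := fun j =>
    (hcD j).comp (f := fun x => z + ς • (x - z)) (by fun_prop)
  calc ∫ x in K, (v x) ^ 2 ≤ ∫ x in Metric.closedBall z h, (v x) ^ 2 :=
        setIntegral_mono_set (hint (hs.continuous.pow 2) h)
          (Filter.Eventually.of_forall fun x => sq_nonneg _) (hKB.eventuallyLE)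
    _ ≤ ∫ x in Metric.closedBall z h, ∑ j ∈ Finset.range (n + 1),
          ((n + 1 : ℝ) * ((1 + ς) * h) ^ (2 * j)) *
            ‖iteratedFDeriv ℝ j v (z + ς • (x - z))‖ ^ 2 := by
        refine setIntegral_mono_on (hint (hs.continuous.pow 2) h)
          (hint (continuous_finsetSum _ fun j _ => continuous_const.mul (hc1 j)) h)
          measurableSet_closedBall fun x hx => ?_
        have e : x = (z + ς • (x - z)) + (1 - ς) • (x - z) := by
          rw [sub_smul, one_smul]; abel
        have := aux_point p hp v hv hs (z + ς • (x - z)) ((1 - ς) • (x - z)) ((1 + ς) * h) (by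
          rw [norm_smul]
          have h1 : ‖x - z‖ ≤ h := by rwa [← dist_eq_norm]
          have h2 : ‖1 - ς‖ ≤ 1 + ς := by
            rw [Real.norm_eq_abs, abs_le]; constructor <;> linarith
          gcongr)
        rwa [← e] at this
    _ = ∑ j ∈ Finset.range (n + 1), ((n + 1 : ℝ) * ((1 + ς) * h) ^ (2 * j)) *
          ((ς ^ d)⁻¹ * ∫ x in Metric.closedBall z (ς * h), ‖iteratedFDeriv ℝ j v x‖ ^ 2) := by
        rw [integral_finsetSum]
        swap
        · exact fun j _ => hint (continuous_const.mul (hc1 j)) h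
        refine Finset.sum_congr rfl fun j _ => ?_
        rw [integral_const_mul, aux_cov (fun x => ‖iteratedFDeriv ℝ j v x‖ ^ 2) z ς h hς]
    _ ≤ _ := by
        refine Finset.sum_le_sum fun j _ => ?_
        have : ∫ x in Metric.closedBall z (ς * h), ‖iteratedFDeriv ℝ j v x‖ ^ 2 ≤
            ∫ x in Metric.closedBall z r, ‖iteratedFDeriv ℝ j v x‖ ^ 2 :=
          setIntegral_mono_set (hint (hcD j) r)
            (Filter.Eventually.of_forall fun x => sq_nonneg _)
            (Metric.closedBall_subset_closedBall hr).eventuallyLE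
        calc _ ≤ ((n + 1 : ℝ) * ((1 + ς) * h) ^ (2 * j)) *
            ((ς ^ d)⁻¹ * ∫ x in Metric.closedBall z r, ‖iteratedFDeriv ℝ j v x‖ ^ 2) := by gcongr
          _ = _ := by rw [mul_pow]; ring
end

section
/- (Domain inverse inequality) Let d ≥ 1 and n ≥ 0 be integers and ς > 0. There exists a constant C > 0, depending only on d, n, and ς, such that for every h > 0, every bounded convex set K ⊂ ℝ^d with diameter at most h, every closed ball S ⊆ K of radius at least ς·h, and every polynomial function v : ℝ^d → ℝ of total degree at most n, one has ∫_K v(x)² dx ≤ C ∫_S v(x)² dx. -/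
open MeasureTheory

namespace InvIneq

abbrev E (d : ℕ) := EuclideanSpace ℝ (Fin d)

theorem cont {d : ℕ} (p : MvPolynomial (Fin d) ℝ) :
    Continuous (fun x : E d => MvPolynomial.eval (fun i => x i) p) := by
  have h1 := MvPolynomial.continuous_eval p
  exact h1.comp (by fun_prop)

theorem memLp {d : ℕ} (s : ℝ) (p : MvPolynomial (Fin d) ℝ) :
    MemLp (fun x : E d => MvPolynomial.eval (fun i => x i) p) 2
      (volume.restrict (Metric.closedBall 0 s)) := by
  obtain ⟨M, hM⟩ := (isCompact_closedBall (0 : E d) s).exists_bound_of_continuousOn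
    (cont p).continuousOn
  haveI : IsFiniteMeasure (volume.restrict (Metric.closedBall (0 : E d) s)) :=
    ⟨by rw [Measure.restrict_apply_univ]; exact measure_closedBall_lt_top⟩
  refine MemLp.of_bound (cont p).aestronglyMeasurable M ?_
  exact (ae_restrict_mem Metric.isClosed_closedBall.measurableSet).mono hM

noncomputable def T (d n : ℕ) (s : ℝ) : MvPolynomial.restrictTotalDegree (Fin d) ℝ n →ₗ[ℝ]
    Lp ℝ 2 (volume.restrict (Metric.closedBall (0 : E d) s)) where
  toFun p := (memLp s p.1).toLp _
  map_add' p q := by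
    rw [← MemLp.toLp_add]
    congr 1
    ext x
    simp
  map_smul' c p := by
    rw [RingHom.id_apply, ← MemLp.toLp_const_smul]
    congr 1
    ext x
    simp

theorem norm_T {d n : ℕ} (s : ℝ) (p : MvPolynomial.restrictTotalDegree (Fin d) ℝ n) :
    ‖T d n s p‖ ^ 2 = ∫ x in Metric.closedBall (0 : E d) s,
      (MvPolynomial.eval (fun i => x i) p.1) ^ 2 := by
  rw [← real_inner_self_eq_norm_sq, L2.inner_def]
  refine integral_congr_ae ?_
  filter_upwards [(memLp s p.1).coeFn_toLp] with x hx
  have : (T d n s p) x = MvPolynomial.eval (fun i => x i) p.1 := hx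
  rw [this]
  simp [sq]

theorem T_inj (d n : ℕ) : Function.Injective (T d n 1) := by
  rw [← LinearMap.ker_eq_bot, LinearMap.ker_eq_bot']
  intro p hp
  have h0 : (memLp 1 p.1).toLp _ = 0 := hp
  have h1 := (memLp 1 p.1).coeFn_toLp
  rw [h0] at h1
  have h2 : (fun x : E d => MvPolynomial.eval (fun i => x i) p.1)
      =ᵐ[volume.restrict (Metric.closedBall (0 : E d) 1)] fun _ => (0 : ℝ) :=
    h1.symm.trans (Lp.coeFn_zero _ _ _)
  have h3 := ae_restrict_of_ae_restrict_of_subset (Metric.ball_subset_closedBall) h2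
  have h4 := Measure.eqOn_open_of_ae_eq h3 Metric.isOpen_ball (cont p.1).continuousOn
    continuousOn_const
  have hc : Continuous (fun y : Fin d → ℝ => (WithLp.toLp 2 y : E d)) := by fun_prop
  have ho := Metric.isOpen_ball (x := (0 : E d)) (ε := 1) |>.preimage hc
  obtain ⟨ε, hε, hsub⟩ := Metric.isOpen_iff.1 ho 0 (by simp)
  apply Subtype.ext
  refine MvPolynomial.funext_set (fun _ => Metric.ball (0 : ℝ) ε) (fun i => ?_) ?_
  · rw [Real.ball_eq_Ioo]
    exact Set.Ioo_infinite (by linarith)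
  · intro x hx
    have hx' : x ∈ Metric.ball (0 : Fin d → ℝ) ε := by
      rw [ball_pi _ hε]; exact hx
    simpa using h4 (hsub hx')

theorem key (d n : ℕ) (s : ℝ) : ∃ C : ℝ, 0 < C ∧ ∀ p : MvPolynomial (Fin d) ℝ,
    p.totalDegree ≤ n →
    ∫ x in Metric.closedBall (0 : E d) s, (MvPolynomial.eval (fun i => x i) p) ^ 2 ≤
    C * ∫ x in Metric.closedBall (0 : E d) 1, (MvPolynomial.eval (fun i => x i) p) ^ 2 := by
  let e := LinearEquiv.ofInjective (T d n 1) (T_inj d n)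
  let L := LinearMap.toContinuousLinearMap ((T d n s).comp e.symm.toLinearMap)
  refine ⟨‖L‖ ^ 2 + 1, by positivity, fun p hp => ?_⟩
  let q : MvPolynomial.restrictTotalDegree (Fin d) ℝ n :=
    ⟨p, (MvPolynomial.mem_restrictTotalDegree _ _ _).2 hp⟩
  have h1 := L.le_opNorm (e q)
  have h2 : L (e q) = T d n s q := by simp [L]
  have h3 : ‖e q‖ = ‖T d n 1 q‖ := rfl
  rw [h2, h3] at h1
  rw [← norm_T s q, ← norm_T 1 q]
  have h4 := pow_le_pow_left₀ (norm_nonneg _) h1 2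
  nlinarith [sq_nonneg ‖T d n 1 q‖]

theorem deg {d n : ℕ} (p : MvPolynomial (Fin d) ℝ) (hp : p.totalDegree ≤ n)
    (g : Fin d → MvPolynomial (Fin d) ℝ) (hg : ∀ i, (g i).totalDegree ≤ 1) :
    (MvPolynomial.aeval g p).totalDegree ≤ n := by
  rw [MvPolynomial.aeval_def, MvPolynomial.eval₂_eq]
  refine MvPolynomial.totalDegree_finsetSum_le fun m hm => ?_
  refine (MvPolynomial.totalDegree_mul _ _).trans ?_
  rw [MvPolynomial.algebraMap_eq, MvPolynomial.totalDegree_C, zero_add]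
  refine (MvPolynomial.totalDegree_finsetProd _ _).trans ?_
  refine le_trans ?_ ((MvPolynomial.le_totalDegree hm).trans hp)
  refine Finset.sum_le_sum fun i _ => ?_
  refine (MvPolynomial.totalDegree_pow _ _).trans ?_
  simpa using Nat.mul_le_mul_left (m i) (hg i)

theorem cov {d : ℕ} (f : E d → ℝ) (z : E d) {r : ℝ} (hr : 0 < r) {s : ℝ} (hs : 0 ≤ s) :
    ∫ x in Metric.closedBall z (r * s), f x =
      r ^ d * ∫ y in Metric.closedBall (0 : E d) s, f (z + r • y) := by
  rw [Measure.setIntegral_comp_smul_of_pos volume (fun u => f (z + u)) _ hr,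
    smul_closedBall _ _ hs]
  have h1 := (measurePreserving_add_left (volume : Measure (E d)) z).setIntegral_preimage_emb
    (measurableEmbedding_addLeft z) f (Metric.closedBall z (r * s))
  have h2 : (fun x => z + x) ⁻¹' (Metric.closedBall z (r * s)) =
      Metric.closedBall (0 : E d) (r * s) := by
    ext x; simp
  rw [h2] at h1
  have : r ^ d ≠ 0 := by positivity
  simp only [smul_zero, finrank_euclideanSpace, Fintype.card_fin, smul_eq_mul, Real.norm_eq_abs,
    abs_of_pos hr]
  rw [h1]
  field_simp

end InvIneq

open InvIneq in
theorem stmt_6 (d n : ℕ) (hd : 1 ≤ d) (ς : ℝ) (hς : 0 < ς) :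
    ∃ C : ℝ, 0 < C ∧
      ∀ (h : ℝ), 0 < h →
      ∀ K : Set (EuclideanSpace ℝ (Fin d)),
        Convex ℝ K → Bornology.IsBounded K → Metric.diam K ≤ h →
      ∀ (z : EuclideanSpace ℝ (Fin d)) (r : ℝ),
        ς * h ≤ r → Metric.closedBall z r ⊆ K →
      ∀ (p : MvPolynomial (Fin d) ℝ), p.totalDegree ≤ n →
      ∀ v : EuclideanSpace ℝ (Fin d) → ℝ,
        (∀ x, v x = MvPolynomial.eval (fun i => x i) p) →
        ∫ x in K, (v x) ^ 2 ≤ C * ∫ x in Metric.closedBall z r, (v x) ^ 2 := by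
  obtain ⟨C, hC, H⟩ := key d n ς⁻¹
  refine ⟨C, hC, fun h hh K _ hb hdiam z r hr hsub p hp v hv => ?_⟩
  have hr0 : 0 < r := lt_of_lt_of_le (by positivity) hr
  have hz : z ∈ K := hsub (Metric.mem_closedBall_self hr0.le)
  have hK : K ⊆ Metric.closedBall z (r * ς⁻¹) := by
    intro x hx
    rw [Metric.mem_closedBall]
    refine ((Metric.dist_le_diam_of_mem hb hx hz).trans hdiam).trans ?_
    rw [← div_eq_mul_inv, le_div_iff₀ hς]; linarith
  have hvc : Continuous v := by
    rw [funext hv]; exact cont p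
  have hint : IntegrableOn (fun x => v x ^ 2) (Metric.closedBall z (r * ς⁻¹)) :=
    (hvc.pow 2).continuousOn.integrableOn_compact (isCompact_closedBall _ _)
  refine (setIntegral_mono_set hint (Filter.Eventually.of_forall fun x => sq_nonneg _)
    hK.eventuallyLE).trans ?_
  let g : Fin d → MvPolynomial (Fin d) ℝ :=
    fun i => MvPolynomial.C (z i) + MvPolynomial.C r * MvPolynomial.X i
  have hg : ∀ i, (g i).totalDegree ≤ 1 := by
    intro i
    refine (MvPolynomial.totalDegree_add _ _).trans (max_le (by simp) ?_)
    refine (MvPolynomial.totalDegree_mul _ _).trans (by simp)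
  have hw : ∀ y : E d, v (z + r • y) =
      MvPolynomial.eval (fun i => y i) (MvPolynomial.aeval g p) := by
    intro y
    rw [hv, MvPolynomial.aeval_eq_bind₁, ← MvPolynomial.coe_aeval_eq_eval,
      ← MvPolynomial.coe_aeval_eq_eval, RingHom.coe_coe, RingHom.coe_coe,
      MvPolynomial.aeval_bind₁]
    congr 2
    ext i
    simp [g]
  have hmain := H _ (deg p hp g hg)
  rw [cov _ z hr0 (inv_pos.2 hς).le]
  have h1 := cov (fun x => v x ^ 2) z hr0 zero_le_one
  rw [mul_one] at h1
  rw [h1]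
  simp only [hw]
  have : 0 < r ^ d := by positivity
  calc _ ≤ r ^ d * _ := mul_le_mul_of_nonneg_left hmain this.le
    _ = _ := by ring
end

section
/- (Inverse inequality) Let d ≥ 1 and n ≥ 0 be integers and ς > 0, γ ≥ 1. There exists a constant C > 0, depending only on d, n, ς, and γ, such that the following holds: for every h > 0, every Lebesgue-measurable set T ⊂ ℝ^d that contains a closed ball of radius at least ς·h and is contained in a bounded convex set K ⊂ ℝ^d of diameter at most γ·h, and every polynomial function φ : ℝ^d → ℝ of total degree at most n, one has ∫_T ‖∇φ(x)‖² dx ≤ C h^{−2} ∫_T φ(x)² dx. -/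
open MeasureTheory

noncomputable def evP (d : ℕ) (p : MvPolynomial (Fin d) ℝ) (x : EuclideanSpace ℝ (Fin d)) : ℝ :=
  MvPolynomial.eval (fun i => x i) p

theorem evP_analytic (d : ℕ) (p : MvPolynomial (Fin d) ℝ) :
    AnalyticOnNhd ℝ (evP d p) Set.univ := by
  have := AnalyticOnNhd.eval_continuousLinearMap' (𝕜 := ℝ)
    (fun i : Fin d => (EuclideanSpace.proj i : EuclideanSpace ℝ (Fin d) →L[ℝ] ℝ)) p
  exact this

theorem evP_contDiff (d : ℕ) (p : MvPolynomial (Fin d) ℝ) :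
    ContDiff ℝ 1 (evP d p) := by
  rw [← contDiffOn_univ]
  exact (evP_analytic d p).contDiffOn uniqueDiffOn_univ

theorem evP_cont (d : ℕ) (p : MvPolynomial (Fin d) ℝ) : Continuous (evP d p) :=
  (evP_contDiff d p).continuous

theorem evP_diff (d : ℕ) (p : MvPolynomial (Fin d) ℝ) : Differentiable ℝ (evP d p) :=
  (evP_contDiff d p).differentiable one_ne_zero

theorem evP_memLp (d : ℕ) (p : MvPolynomial (Fin d) ℝ) (s : ℝ) :
    MemLp (evP d p) 2 (volume.restrict (Metric.closedBall (0 : EuclideanSpace ℝ (Fin d)) s)) := by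
  rw [memLp_two_iff_integrable_sq (evP_cont d p).aestronglyMeasurable]
  exact ((evP_cont d p).pow 2).continuousOn.integrableOn_compact (isCompact_closedBall _ _)

theorem evP_add (d : ℕ) (p q : MvPolynomial (Fin d) ℝ) : evP d (p + q) = evP d p + evP d q := by
  ext x; simp [evP]

theorem evP_smul (d : ℕ) (c : ℝ) (q : MvPolynomial (Fin d) ℝ) : evP d (c • q) = c • evP d q := by
  ext x; simp [evP]

noncomputable def JL (d : ℕ) (s : ℝ) : MvPolynomial (Fin d) ℝ →ₗ[ℝ]
    Lp ℝ 2 (volume.restrict (Metric.closedBall (0 : EuclideanSpace ℝ (Fin d)) s)) where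
  toFun p := (evP_memLp d p s).toLp _
  map_add' p q := by
    rw [← MemLp.toLp_add]; congr 1; exact evP_add d p q
  map_smul' c q := by
    simp only [RingHom.id_apply]
    rw [← MemLp.toLp_const_smul]; congr 1; exact evP_smul d c q

theorem JL_inj (d : ℕ) (s : ℝ) (hs : 0 < s) (p : MvPolynomial (Fin d) ℝ) (h : JL d s p = 0) :
    p = 0 := by
  have h1 : (evP d p) =ᵐ[volume.restrict (Metric.closedBall (0 : EuclideanSpace ℝ (Fin d)) s)]
      (fun _ => 0) := by
    have := (MemLp.toLp_eq_toLp_iff (evP_memLp d p s)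
      (MemLp.zero' (ε := ℝ))).1 (h.trans (MemLp.toLp_zero _).symm)
    exact this
  have h2 := Measure.eqOn_open_of_ae_eq
    (ae_restrict_of_ae_restrict_of_subset Metric.ball_subset_closedBall h1) Metric.isOpen_ball
    (evP_cont d p).continuousOn continuousOn_const
  have h3 : evP d p = fun _ => 0 := by
    refine AnalyticOnNhd.eq_of_eventuallyEq (𝕜 := ℝ) (z₀ := 0) (evP_analytic d p)
      analyticOnNhd_const ?_
    filter_upwards [Metric.ball_mem_nhds 0 hs] with x hx using h2 hx
  apply MvPolynomial.funext
  intro x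
  simpa [evP] using congrFun h3 (WithLp.toLp 2 x)

theorem JL_norm (d : ℕ) (s : ℝ) (p : MvPolynomial (Fin d) ℝ) :
    ‖JL d s p‖ ^ 2 = ∫ x in Metric.closedBall (0 : EuclideanSpace ℝ (Fin d)) s, evP d p x ^ 2 := by
  rw [← real_inner_self_eq_norm_sq, L2.inner_def]
  apply integral_congr_ae
  filter_upwards [(evP_memLp d p s).coeFn_toLp] with x hx
  have : (JL d s p) x = evP d p x := hx
  simp [this, sq]

noncomputable def GradL (d : ℕ) (γ : ℝ) : MvPolynomial (Fin d) ℝ →ₗ[ℝ]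
    C(Metric.closedBall (0 : EuclideanSpace ℝ (Fin d)) γ, EuclideanSpace ℝ (Fin d) →L[ℝ] ℝ) where
  toFun p := ⟨fun x => fderiv ℝ (evP d p) x,
    ((evP_contDiff d p).continuous_fderiv one_ne_zero).comp continuous_subtype_val⟩
  map_add' p q := by
    ext1 x
    simp only [ContinuousMap.coe_mk, ContinuousMap.add_apply, evP_add]
    exact fderiv_add (evP_diff d p _) (evP_diff d q _)
  map_smul' c q := by
    ext1 x
    simp only [ContinuousMap.coe_mk, ContinuousMap.smul_apply, evP_smul, RingHom.id_apply]
    exact fderiv_const_smul (evP_diff d q _) c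

theorem bound_fd {V W U : Type*} [AddCommGroup V] [Module ℝ V] [Module.Finite ℝ V]
    [NormedAddCommGroup W] [NormedSpace ℝ W] [NormedAddCommGroup U] [NormedSpace ℝ U]
    (J : V →ₗ[ℝ] W) (hJ : Function.Injective J) (G : V →ₗ[ℝ] U) :
    ∃ C : ℝ, 0 < C ∧ ∀ v, ‖G v‖ ≤ C * ‖J v‖ := by
  let e := LinearEquiv.ofInjective J hJ
  let L : LinearMap.range J →L[ℝ] U := (G.comp e.symm.toLinearMap).toContinuousLinearMap
  refine ⟨‖L‖ + 1, by positivity, fun v => ?_⟩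
  have h := L.le_opNorm (e v)
  have h1 : L (e v) = G v := by simp [L]
  have h2 : ‖e v‖ = ‖J v‖ := rfl
  rw [h1, h2] at h
  nlinarith [norm_nonneg (J v)]

theorem ref_bound (d n : ℕ) (s γ : ℝ) (hs : 0 < s) :
    ∃ C : ℝ, 0 < C ∧ ∀ p : MvPolynomial (Fin d) ℝ, p.totalDegree ≤ n →
      ∀ x ∈ Metric.closedBall (0 : EuclideanSpace ℝ (Fin d)) γ,
      ‖fderiv ℝ (evP d p) x‖ ^ 2 ≤
        C * ∫ x in Metric.closedBall (0 : EuclideanSpace ℝ (Fin d)) s, evP d p x ^ 2 := by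
  let V := MvPolynomial.restrictTotalDegree (Fin d) ℝ n
  haveI : CompactSpace (Metric.closedBall (0 : EuclideanSpace ℝ (Fin d)) γ) :=
    isCompact_iff_compactSpace.1 (isCompact_closedBall _ _)
  obtain ⟨C, hC, h⟩ := bound_fd
    (U := C(Metric.closedBall (0 : EuclideanSpace ℝ (Fin d)) γ, EuclideanSpace ℝ (Fin d) →L[ℝ] ℝ))
    ((JL d s).comp V.subtype) (by
    rw [injective_iff_map_eq_zero]
    intro v hv
    exact Subtype.ext (JL_inj d s hs _ hv)) ((GradL d γ).comp V.subtype)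
  refine ⟨C ^ 2, by positivity, fun p hp x hx => ?_⟩
  have h1 := h ⟨p, (MvPolynomial.mem_restrictTotalDegree _ _ _).2 hp⟩
  have h2 : ‖fderiv ℝ (evP d p) x‖ ≤ ‖GradL d γ p‖ := (GradL d γ p).norm_coe_le_norm ⟨x, hx⟩
  have h3 : ‖fderiv ℝ (evP d p) x‖ ≤ C * ‖JL d s p‖ := h2.trans h1
  rw [← JL_norm, ← mul_pow]
  gcongr

theorem scale_poly (d : ℕ) (p : MvPolynomial (Fin d) ℝ) (z : EuclideanSpace ℝ (Fin d)) (h : ℝ) :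
    ∃ q : MvPolynomial (Fin d) ℝ, q.totalDegree ≤ p.totalDegree ∧
      ∀ y, evP d q y = evP d p (z + h • y) := by
  refine ⟨MvPolynomial.bind₁
    (fun i => MvPolynomial.C (z i) + MvPolynomial.C h * MvPolynomial.X i) p, ?_, ?_⟩
  · conv_lhs => rw [p.as_sum, map_sum]
    apply MvPolynomial.totalDegree_finsetSum_le
    intro m hm
    rw [MvPolynomial.bind₁_monomial]
    refine (MvPolynomial.totalDegree_mul _ _).trans ?_
    rw [MvPolynomial.totalDegree_C, zero_add]
    refine (MvPolynomial.totalDegree_finsetProd _ _).trans ?_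
    refine le_trans ?_ (MvPolynomial.le_totalDegree hm)
    rw [Finsupp.sum]
    apply Finset.sum_le_sum
    intro i _
    refine (MvPolynomial.totalDegree_pow _ _).trans ?_
    have : (MvPolynomial.C (z i) + MvPolynomial.C h * MvPolynomial.X i :
        MvPolynomial (Fin d) ℝ).totalDegree ≤ 1 := by
      refine (MvPolynomial.totalDegree_add _ _).trans (max_le (by simp) ?_)
      refine (MvPolynomial.totalDegree_mul _ _).trans ?_
      simp
    nlinarith
  · intro y
    simp only [evP]
    rw [← MvPolynomial.coe_aeval_eq_eval, ← MvPolynomial.coe_aeval_eq_eval]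
    simp only [RingHom.coe_coe]
    rw [MvPolynomial.aeval_bind₁]
    simp

theorem stmt_7 (d n : ℕ) (hd : 1 ≤ d) (ς γ : ℝ) (hς : 0 < ς) (hγ : 1 ≤ γ) :
    ∃ C : ℝ, 0 < C ∧
      ∀ (h : ℝ), 0 < h →
      ∀ T : Set (EuclideanSpace ℝ (Fin d)), MeasurableSet T →
      ∀ (z : EuclideanSpace ℝ (Fin d)) (r : ℝ),
        ς * h ≤ r → Metric.closedBall z r ⊆ T →
      ∀ K : Set (EuclideanSpace ℝ (Fin d)),
        Convex ℝ K → Bornology.IsBounded K → Metric.diam K ≤ γ * h → T ⊆ K →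
      ∀ (p : MvPolynomial (Fin d) ℝ), p.totalDegree ≤ n →
      ∀ φ : EuclideanSpace ℝ (Fin d) → ℝ,
        (∀ x, φ x = MvPolynomial.eval (fun i => x i) p) →
        ∫ x in T, ‖gradient φ x‖ ^ 2 ≤ C * h ^ (-2 : ℤ) * ∫ x in T, (φ x) ^ 2 := by
  obtain ⟨C, hC, hb⟩ := ref_bound d n ς γ hς
  have hγ0 : 0 < γ := by linarith
  set B := volume.real (Metric.closedBall (0 : EuclideanSpace ℝ (Fin d)) γ) with hB
  have hB0 : 0 < B := by
    apply ENNReal.toReal_pos (Metric.measure_closedBall_pos _ _ hγ0).ne' measure_closedBall_lt_top.ne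
  refine ⟨C * B, by positivity, ?_⟩
  intro h hh T hT z r hr hzT K _ hKb hKd hTK p hp φ hφ
  obtain rfl : φ = evP d p := funext hφ
  obtain ⟨q, hqd, hq⟩ := scale_poly d p z h
  have hzr : z ∈ T := hzT (Metric.mem_closedBall_self (le_trans (by positivity) hr))
  have hTb : T ⊆ Metric.closedBall z (h * γ) := fun x hx => by
    rw [Metric.mem_closedBall, mul_comm]
    exact (Metric.dist_le_diam_of_mem hKb (hTK hx) (hTK hzr)).trans hKd
  set I := ∫ x in Metric.closedBall (0 : EuclideanSpace ℝ (Fin d)) ς, evP d q x ^ 2 with hI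
  have hI0 : 0 ≤ I := integral_nonneg fun x => sq_nonneg _
  have hpt : ∀ x ∈ T, ‖‖gradient (evP d p) x‖ ^ 2‖ ≤ h ^ (-2 : ℤ) * (C * I) := by
    intro x hx
    have hy : h⁻¹ • (x - z) ∈ Metric.closedBall (0 : EuclideanSpace ℝ (Fin d)) γ := by
      have := hTb hx
      rw [Metric.mem_closedBall, dist_eq_norm] at this
      rw [mem_closedBall_zero_iff, norm_smul, norm_inv, Real.norm_of_nonneg hh.le,
        inv_mul_le_iff₀ hh]
      exact this
    have h1 := hb q (hqd.trans hp) _ hy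
    have h2 : fderiv ℝ (evP d q) (h⁻¹ • (x - z)) = h • fderiv ℝ (evP d p) x := by
      have e : evP d q = fun y => (fun w => evP d p (z + w)) (h • y) := funext hq
      rw [e]
      refine (fderiv_comp_smul (f := fun w => evP d p (z + w)) h).trans ?_
      rw [fderiv_comp_add_left]
      rw [smul_inv_smul₀ hh.ne', add_sub_cancel]
    rw [h2, norm_smul, Real.norm_of_nonneg hh.le, mul_pow] at h1
    have h3 : ‖gradient (evP d p) x‖ = ‖fderiv ℝ (evP d p) x‖ := by
      simp [gradient]
    rw [norm_pow, norm_norm, h3, zpow_neg, le_inv_mul_iff₀ (by positivity)]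
    exact_mod_cast h1
  have hvolT : volume T < ⊤ := (measure_mono hTb).trans_lt measure_closedBall_lt_top
  have hmeas : volume.real T ≤ h ^ d * B := by
    refine (measureReal_mono hTb measure_closedBall_lt_top.ne).trans ?_
    rw [Measure.real, Measure.addHaar_closedBall_mul _ _ hh.le hγ0.le, ENNReal.toReal_mul,
      ENNReal.toReal_ofReal (by positivity), finrank_euclideanSpace_fin]
    rfl
  have hint : h ^ d * I = ∫ x in Metric.closedBall z (h * ς), evP d p x ^ 2 := by
    have e1 : I = ∫ x in Metric.closedBall (0 : EuclideanSpace ℝ (Fin d)) ς,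
        (fun w => evP d p (z + w) ^ 2) (h • x) := by
      simp only [hI, hq]
    rw [e1, Measure.setIntegral_comp_smul_of_pos volume (fun w => evP d p (z + w) ^ 2) _ hh,
      finrank_euclideanSpace_fin, smul_eq_mul,
      mul_inv_cancel_left₀ (by positivity)]
    have := (measurePreserving_add_left (volume : Measure (EuclideanSpace ℝ (Fin d))) z
      ).setIntegral_preimage_emb (measurableEmbedding_addLeft z) (fun x => evP d p x ^ 2)
      (Metric.closedBall z (h * ς))
    rw [← this]
    congr 2
    ext x
    simp [smul_closedBall _ _ hς.le, abs_of_pos hh]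
  have hle : h ^ d * I ≤ ∫ x in T, evP d p x ^ 2 := by
    rw [hint]
    refine setIntegral_mono_set ?_ (Filter.Eventually.of_forall fun x => sq_nonneg _)
      (Filter.Eventually.of_forall ?_)
    · exact (((evP_cont d p).pow 2).continuousOn.integrableOn_compact
        (isCompact_closedBall z (h * γ))).mono_set hTb
    · exact (Metric.closedBall_subset_closedBall (by linarith)).trans hzT
  have h1 := (le_abs_self _).trans (norm_setIntegral_le_of_norm_le_const hvolT hpt)
  have hz : (0 : ℝ) < h ^ (-2 : ℤ) := by positivity
  calc _ ≤ _ := h1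
    _ ≤ h ^ (-2 : ℤ) * (C * I) * (h ^ d * B) := by gcongr
    _ = C * B * h ^ (-2 : ℤ) * (h ^ d * I) := by ring
    _ ≤ _ := by gcongr
end
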